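/- Let f be a subgraph counting function with parameters p ∈ (0,1), distinct integers m₁,…,m_l ≥ 2 and weights α₁,…,α_l ∈ ℝ, and let μ_f be the associated Gibbs measure on {0,1}^n. Then there exists a probability measure ρ on [0,1]^n such that ρ(X_f) ≥ 1 − 80 C_α^{1/4} n^{−1/8}, and there exists a coupling π of G(n,ρ) and μ_f (a probability measure on {0,1}^n × {0,1}^n whose first marginal is G(n,ρ) and whose second marginal is μ_f) satisfying ∫ ‖x − y‖₁ dπ(x,y) ≤ 80 C_α^{1/4} n^{7/8}. -/

import Mathlib

open MeasureTheory ProbabilityTheory Real Set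

noncomputable section

/-- The real-valued vertex configuration associated to a boolean configuration. -/
def boolToR (n : ℕ) (X : Fin n → Bool) : Fin n → ℝ := fun i => if X i then 1 else 0

/-- The 1-norm on ℝⁿ. -/
def norm1 (n : ℕ) (x : Fin n → ℝ) : ℝ := ∑ i, |x i|

/-- `C_j^m(X)`: the sum over (m-1)-tuples of pairwise distinct indices, all distinct
from `j`, of the products of the corresponding entries of `X`; `C_j^1 = 1`. -/
def Cvec (n m : ℕ) (X : Fin n → ℝ) (j : Fin n) : ℝ :=
  ∑ g ∈ Finset.univ.filter (fun g : Fin (m - 1) ↪ Fin n => ∀ k, g k ≠ j),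
    ∏ k, X (g k)

/-- The subgraph counting function with parameters `p`, `m₁,…,m_l`, `α₁,…,α_l`. -/
def scf (n l : ℕ) (p : ℝ) (m : Fin l → ℕ) (α : Fin l → ℝ) (X : Fin n → ℝ) : ℝ :=
  (∑ q, (α q / (n : ℝ) ^ (m q - 1)) * ∑ g : Fin (m q) ↪ Fin n, ∏ k, X (g k)) +
    Real.log (p / (1 - p)) * ∑ i, |X i|

/-- The discrete derivative `∂ⱼf(X) = (f(X^{j←1}) - f(X^{j←0}))/2`. -/
def dder (n : ℕ) (f : (Fin n → ℝ) → ℝ) (X : Fin n → ℝ) (j : Fin n) : ℝ :=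
  (f (Function.update X j 1) - f (Function.update X j 0)) / 2

/-- The polynomial extension of the discrete gradient of the subgraph counting function:
`∂ⱼf(X) = Σ_q (m_q α_q/(2 n^{m_q-1})) C_j^{m_q}(X) + ½ log(p/(1-p))`. -/
def gradf (n l : ℕ) (p : ℝ) (m : Fin l → ℕ) (α : Fin l → ℝ) (X : Fin n → ℝ)
    (j : Fin n) : ℝ :=
  (∑ q, ((m q : ℝ) * α q / (2 * (n : ℝ) ^ (m q - 1))) * Cvec n (m q) X j) +
    Real.log (p / (1 - p)) / 2

/-- `C_α = max{2, ½|log(p/(1-p))| + ½ Σ_q |α_q| m_q (m_q - 1)}`. -/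
def Calpha (l : ℕ) (p : ℝ) (m : Fin l → ℕ) (α : Fin l → ℝ) : ℝ :=
  max 2 (|Real.log (p / (1 - p))| / 2 + (∑ q, |α q| * (m q : ℝ) * ((m q : ℝ) - 1)) / 2)

/-- `Φ(X) = (1ₙ + tanh(∇f(X)))/2`, entrywise. -/
def Phi (n l : ℕ) (p : ℝ) (m : Fin l → ℕ) (α : Fin l → ℝ) (X : Fin n → ℝ) :
    Fin n → ℝ :=
  fun j => (1 + Real.tanh (gradf n l p m α X j)) / 2

/-- The set `X_f` of near fixed points of `X ↦ (1ₙ + tanh(∇f(X)))/2` in `[0,1]ⁿ`. -/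
def Xf (n l : ℕ) (p : ℝ) (m : Fin l → ℕ) (α : Fin l → ℝ) : Set (Fin n → ℝ) :=
  {X | (∀ i, X i ∈ Set.Icc (0:ℝ) 1) ∧
    norm1 n (fun j => X j - Phi n l p m α X j) ≤
      5000 * (Calpha l p m α) ^ 2 * (n : ℝ) ^ ((7:ℝ)/8)}

/-- The one-dimensional fixed point function `φ_α`. -/
def phiA (n l : ℕ) (p : ℝ) (m : Fin l → ℕ) (α : Fin l → ℝ) (x : ℝ) : ℝ :=
  (1 + Real.tanh (Real.log (p / (1 - p)) / 2 +
    (∑ q, (m q : ℝ) * α q * (∏ i ∈ Finset.Icc 1 (m q - 1), (1 - (i : ℝ) / n)) *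
      x ^ (m q - 1)) / 2)) / 2

/-- The Gibbs measure `μ_f({X}) = e^{f(X)}/Z` on `{0,1}ⁿ`, viewed as a measure on `ℝⁿ`
supported on the corners of the cube. -/
def gibbs (n : ℕ) (f : (Fin n → ℝ) → ℝ) : Measure (Fin n → ℝ) :=
  (∑ X : Fin n → Bool, ENNReal.ofReal (Real.exp (f (boolToR n X))))⁻¹ •
    ∑ X : Fin n → Bool, ENNReal.ofReal (Real.exp (f (boolToR n X))) •
      Measure.dirac (boolToR n X)

/-- The Bernoulli measure with parameter `t` on `ℝ`. -/
def bern (t : ℝ) : Measure ℝ :=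
  t.toNNReal • Measure.dirac 1 + (1 - t).toNNReal • Measure.dirac 0

/-- The mixture `G(n,ρ) : B ↦ ∫ (⊗ᵢ Bernoulli(pᵢ))(B) dρ(p₁,…,pₙ)`. -/
def Gmix (n : ℕ) (ρ : Measure (Fin n → ℝ)) : Measure (Fin n → ℝ) :=
  ρ.bind fun q => Measure.pi fun i => bern (q i)


def sg (h : ℝ) : ℝ := (1 + Real.tanh h) / 2

lemma sg_eq (h : ℝ) : sg h * (1 + exp (-(2*h))) = 1 := by
  unfold sg
  rw [Real.tanh_eq_sinh_div_cosh, Real.sinh_eq, Real.cosh_eq]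
  have h1 : exp h ≠ 0 := (exp_pos h).ne'
  have : exp (-(2*h)) = exp (-h) * exp (-h) := by rw [← exp_add]; ring_nf
  rw [this]
  have h2 : exp h * exp (-h) = 1 := by rw [← exp_add]; simp
  have h3 : exp h + exp (-h) ≠ 0 := by positivity
  field_simp
  linear_combination (2 * exp (-h)) * h2

lemma sg_nonneg (h : ℝ) : 0 ≤ sg h := by
  by_contra hc
  have := sg_eq h
  have h2 : 0 < 1 + exp (-(2*h)) := by positivity
  nlinarith

lemma sg_le_one (h : ℝ) : sg h ≤ 1 := by
  have := sg_eq h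
  have h2 : 0 < exp (-(2*h)) := by positivity
  nlinarith [sg_nonneg h]

lemma sg_balance (h : ℝ) : (1 - sg h) * exp (2*h) = sg h := by
  have := sg_eq h
  have h2 : exp (2*h) * exp (-(2*h)) = 1 := by rw [← exp_add]; simp
  linear_combination (-exp (2*h)) * this + sg h * h2

lemma sg_lip (a b : ℝ) : |sg a - sg b| ≤ |a - b| := by
  have hd : ∀ x : ℝ, HasDerivAt Real.tanh (1 / cosh x ^ 2) x := by
    intro x
    have h1 := (Real.hasDerivAt_sinh x).div (Real.hasDerivAt_cosh x) (Real.cosh_pos x).ne'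
    have h2 : Real.tanh = Real.sinh / Real.cosh := by
      funext y; simp [Real.tanh_eq_sinh_div_cosh]
    rw [h2]
    refine h1.congr_deriv ?_
    have := Real.cosh_sq x
    rw [show cosh x * cosh x - sinh x * sinh x = 1 by linarith]
  have h := (convex_univ (𝕜 := ℝ) (E := ℝ)).norm_image_sub_le_of_norm_hasDerivWithin_le
    (f := Real.tanh) (C := 1) (f' := fun x => 1 / cosh x ^ 2)
    (fun x _ => (hd x).hasDerivWithinAt) (fun x _ => by
      rw [Real.norm_of_nonneg (by positivity)]
      have := Real.one_le_cosh x
      rw [div_le_one (by positivity)]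
      nlinarith) (mem_univ b) (mem_univ a)
  simp only [Real.norm_eq_abs, one_mul] at h
  have : sg a - sg b = (Real.tanh a - Real.tanh b) / 2 := by unfold sg; ring
  rw [this, abs_div, abs_two]
  linarith [abs_nonneg (Real.tanh a - Real.tanh b)]

lemma desc_cast (a r : ℕ) :
    ((a.descFactorial (r+1) : ℕ) : ℝ) = ((a:ℝ) - r) * (a.descFactorial r : ℝ) := by
  rw [Nat.descFactorial_succ]
  by_cases h : r ≤ a
  · push_cast [Nat.cast_sub h]; ring
  · push Not at h
    rw [Nat.descFactorial_eq_zero_iff_lt.2 h]; simp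

lemma desc_diff (a r : ℕ) :
    (((a+1).descFactorial (r+1) : ℕ) : ℝ) - (a.descFactorial (r+1) : ℝ)
      = (r+1) * (a.descFactorial r : ℝ) := by
  rw [desc_cast a r, Nat.succ_descFactorial_succ]
  push_cast; ring

/-- one-dim potential -/
def F1 (n l : ℕ) (p : ℝ) (m : Fin l → ℕ) (α : Fin l → ℝ) (a : ℕ) : ℝ :=
  (∑ q, (α q / (n : ℝ) ^ (m q - 1)) * (a.descFactorial (m q) : ℝ)) +
    Real.log (p / (1 - p)) * a

def h1 (n l : ℕ) (p : ℝ) (m : Fin l → ℕ) (α : Fin l → ℝ) (a : ℕ) : ℝ :=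
  (∑ q, ((m q : ℝ) * α q / (2 * (n : ℝ) ^ (m q - 1))) * (a.descFactorial (m q - 1) : ℝ)) +
    Real.log (p / (1 - p)) / 2

def H1 (n l : ℕ) (p : ℝ) (m : Fin l → ℕ) (α : Fin l → ℝ) (x : ℝ) : ℝ :=
  (∑ q, ((m q : ℝ) * α q / (2 * (n : ℝ) ^ (m q - 1))) *
    (((n-1).descFactorial (m q - 1) : ℝ) * x ^ (m q - 1))) +
    Real.log (p / (1 - p)) / 2

section one
variable {n l : ℕ} (hn : 0 < n) {p : ℝ} {m : Fin l → ℕ} (hm : ∀ q, 2 ≤ m q) {α : Fin l → ℝ}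

include hm in
lemma F1_diff (a : ℕ) : F1 n l p m α (a+1) - F1 n l p m α a = 2 * h1 n l p m α a := by
  unfold F1 h1
  have : ∀ q, (α q / (n : ℝ) ^ (m q - 1)) * ((a+1).descFactorial (m q) : ℝ)
      = (α q / (n : ℝ) ^ (m q - 1)) * (a.descFactorial (m q) : ℝ) +
        2 * (((m q : ℝ) * α q / (2 * (n : ℝ) ^ (m q - 1))) * (a.descFactorial (m q - 1) : ℝ)) := by
    intro q
    obtain ⟨r, hr⟩ : ∃ r, m q = r + 1 := ⟨m q - 1, by have := hm q; omega⟩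
    have := desc_diff a r
    rw [hr, Nat.add_sub_cancel]
    have e : (((a+1).descFactorial (r+1) : ℕ) : ℝ) = (a.descFactorial (r+1) : ℝ)
      + (r+1) * (a.descFactorial r : ℝ) := by linarith
    rw [e, mul_comm 2 ((n:ℝ)^r), ← div_div]; push_cast; ring
  simp_rw [this]
  rw [Finset.sum_add_distrib, ← Finset.mul_sum]
  push_cast; ring

lemma Calpha_ge_two : 2 ≤ Calpha l p m α := le_max_left _ _

lemma sum_le_Calpha : (∑ q, |α q| * (m q : ℝ) * ((m q : ℝ) - 1)) / 2 ≤ Calpha l p m α := by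
  refine le_trans ?_ (le_max_right _ _)
  linarith [abs_nonneg (Real.log (p / (1 - p)))]

include hn in
/-- generic comparison -/
lemma sum_bound (A B : Fin l → ℝ) (ε : ℝ) (hε : 0 ≤ ε)
    (hAB : ∀ q, |A q - B q| ≤ (n:ℝ)^(m q - 1) * (((m q : ℝ) - 1) * ε)) :
    |(∑ q, ((m q : ℝ) * α q / (2 * (n : ℝ) ^ (m q - 1))) * A q) -
      (∑ q, ((m q : ℝ) * α q / (2 * (n : ℝ) ^ (m q - 1))) * B q)| ≤ Calpha l p m α * ε := by
  rw [← Finset.sum_sub_distrib]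
  refine (Finset.abs_sum_le_sum_abs _ _).trans ?_
  refine le_trans ?_ (mul_le_mul_of_nonneg_right (sum_le_Calpha (p := p) (m := m) (α := α)) hε)
  rw [Finset.sum_div, Finset.sum_mul]
  refine Finset.sum_le_sum fun q _ => ?_
  have hn' : (0:ℝ) < (n:ℝ)^(m q - 1) := by positivity
  rw [← mul_sub, abs_mul, abs_div, abs_mul, abs_of_nonneg (by positivity : (0:ℝ) ≤ m q),
    abs_of_pos (by positivity : 0 < 2 * (n:ℝ)^(m q - 1))]
  calc (m q : ℝ) * |α q| / (2 * (n:ℝ)^(m q - 1)) * |A q - B q|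
      ≤ (m q : ℝ) * |α q| / (2 * (n:ℝ)^(m q - 1)) * ((n:ℝ)^(m q - 1) * (((m q : ℝ) - 1) * ε)) := by
        gcongr; exact hAB q
    _ = _ := by field_simp

include hn hm in
lemma h1_diff (a : ℕ) (ha : a ≤ n) :
    |h1 n l p m α (a+1) - h1 n l p m α a| ≤ Calpha l p m α * (1 / n) := by
  unfold h1
  rw [add_sub_add_right_eq_sub]
  apply sum_bound hn
  · positivity
  intro q
  obtain ⟨r, hr⟩ : ∃ r, m q = r + 2 := ⟨m q - 2, by have := hm q; omega⟩
  rw [hr, show r + 2 - 1 = r + 1 by omega, desc_diff, abs_of_nonneg (by positivity)]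
  have h2 : (a.descFactorial r : ℝ) ≤ (n:ℝ)^r := by
    exact_mod_cast (Nat.descFactorial_le_pow a r).trans (Nat.pow_le_pow_left ha r)
  have hn' : (0:ℝ) < n := by exact_mod_cast hn
  calc ((r:ℝ)+1) * (a.descFactorial r : ℝ) ≤ (r+1) * (n:ℝ)^r := by gcongr
    _ = _ := by push_cast; field_simp; ring

lemma pow_desc {n k a : ℕ} (hk : k ≤ n) (h1 : a ≤ k) (h2 : k ≤ a + 1) (r : ℕ) :
    2 * (n:ℝ) * ((k:ℝ)^r - (a.descFactorial r : ℝ)) ≤ (n:ℝ)^r * (r * (r+1)) := by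
  induction r with
  | zero => simp
  | succ r ih =>
    have hd : (a.descFactorial r : ℝ) ≤ (n:ℝ)^r := by
      exact_mod_cast (Nat.descFactorial_le_pow a r).trans (Nat.pow_le_pow_left (h1.trans hk) r)
    have hd0 : (0:ℝ) ≤ (a.descFactorial r : ℝ) := by positivity
    have hkn : (k:ℝ) ≤ n := by exact_mod_cast hk
    have h2' : (k:ℝ) ≤ a + 1 := by exact_mod_cast h2
    have hge : (a.descFactorial r : ℝ) ≤ (k:ℝ)^r := by
      exact_mod_cast (Nat.descFactorial_le_pow a r).trans (Nat.pow_le_pow_left h1 r)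
    rw [desc_cast]
    have e : 2 * (n:ℝ) * ((k:ℝ)^(r+1) - ((a:ℝ) - r) * (a.descFactorial r : ℝ))
      = k * (2 * (n:ℝ) * ((k:ℝ)^r - (a.descFactorial r : ℝ))) +
        2 * n * ((k - a + r) * (a.descFactorial r : ℝ)) := by ring
    rw [e]
    have i1 : (k:ℝ) * (2 * (n:ℝ) * ((k:ℝ)^r - (a.descFactorial r : ℝ))) ≤
        n * ((n:ℝ)^r * (r * (r+1))) := by
      apply mul_le_mul hkn ih
      · have := sub_nonneg.2 hge; positivity
      · positivity
    have i2 : ((k:ℝ) - a + r) * (a.descFactorial r : ℝ) ≤ (r+1) * (n:ℝ)^r := by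
      apply mul_le_mul (by linarith) hd hd0 (by positivity)
    have i3 : 2 * (n:ℝ) * (((k:ℝ) - a + r) * (a.descFactorial r : ℝ)) ≤
      2 * n * ((r+1) * (n:ℝ)^r) := mul_le_mul_of_nonneg_left i2 (by positivity)
    push_cast
    calc _ ≤ _ := add_le_add i1 i3
      _ = _ := by ring

lemma pow_desc' {n k a : ℕ} (hn : 0 < n) (hk : k ≤ n) (h1 : a ≤ k) (h2 : k ≤ a + 1) (r : ℕ)
    (hr : 1 ≤ r) :
    ((k:ℝ)^r - (a.descFactorial r : ℝ)) ≤ (n:ℝ)^r * (r * (1 / √n)) := by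
  have hn' : (0:ℝ) < n := by exact_mod_cast hn
  have hP : (0:ℝ) < (n:ℝ)^r := by positivity
  have hr' : (1:ℝ) ≤ r := by exact_mod_cast hr
  set y := ((k:ℝ)^r - (a.descFactorial r : ℝ)) / (n:ℝ)^r with hy
  have hyy : ((k:ℝ)^r - (a.descFactorial r : ℝ)) = (n:ℝ)^r * y := by rw [hy]; field_simp
  have h0 : y ≤ 1 := by
    rw [hy, div_le_one hP]
    have : (k:ℝ)^r ≤ (n:ℝ)^r := by exact_mod_cast Nat.pow_le_pow_left hk r
    have : (0:ℝ) ≤ (a.descFactorial r : ℝ) := by positivity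
    linarith
  have h00 : 0 ≤ y := by
    apply div_nonneg _ hP.le
    have : (a.descFactorial r : ℝ) ≤ (k:ℝ)^r := by
      exact_mod_cast (Nat.descFactorial_le_pow a r).trans (Nat.pow_le_pow_left h1 r)
    linarith
  have h3 : (n:ℝ) * y ≤ r ^ 2 := by
    have := pow_desc hk h1 h2 r
    rw [hyy] at this
    have : (n:ℝ)^r * (2 * n * y) ≤ (n:ℝ)^r * (r * (r+1)) := by linarith
    have := le_of_mul_le_mul_left this hP
    nlinarith
  rw [hyy]
  apply mul_le_mul_of_nonneg_left _ hP.le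
  rw [mul_one_div, le_div_iff₀ (by positivity)]
  apply le_of_sq_le_sq _ (by positivity)
  rw [mul_pow, Real.sq_sqrt hn'.le]
  nlinarith

include hn hm in
lemma h1_H1 (k a : ℕ) (hk : k ≤ n) (ha : a ≤ k) (ha2 : k ≤ a + 1) :
    |h1 n l p m α a - H1 n l p m α ((k:ℝ)/n)| ≤ Calpha l p m α * (1 / √n) := by
  unfold h1 H1
  rw [add_sub_add_right_eq_sub]
  apply sum_bound hn
  · positivity
  intro q
  obtain ⟨r, hr⟩ : ∃ r, m q = r + 1 := ⟨m q - 1, by have := hm q; omega⟩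
  have hr1 : 1 ≤ r := by have := hm q; omega
  rw [hr, Nat.add_sub_cancel, show ((r+1:ℕ):ℝ) - 1 = r by push_cast; ring]
  have hn' : (0:ℝ) < n := by exact_mod_cast hn
  have i1 := pow_desc' hn hk ha ha2 r hr1
  have i2 := pow_desc' hn le_rfl (Nat.sub_le n 1) (by omega) r hr1
  have hge : (a.descFactorial r : ℝ) ≤ (k:ℝ)^r := by
    exact_mod_cast (Nat.descFactorial_le_pow a r).trans (Nat.pow_le_pow_left ha r)
  have hge2 : ((n-1).descFactorial r : ℝ) ≤ (n:ℝ)^r := by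
    exact_mod_cast (Nat.descFactorial_le_pow _ r).trans (Nat.pow_le_pow_left (Nat.sub_le n 1) r)
  have hx0 : 0 ≤ ((k:ℝ)/n)^r := by positivity
  have hx1 : ((k:ℝ)/n)^r ≤ 1 := by
    apply pow_le_one₀ (by positivity)
    rw [div_le_one hn']; exact_mod_cast hk
  have hxe : (n:ℝ)^r * ((k:ℝ)/n)^r = (k:ℝ)^r := by rw [← mul_pow]; congr 1; field_simp
  have j1 : 0 ≤ ((n:ℝ)^r - ((n-1).descFactorial r : ℝ)) * ((k:ℝ)/n)^r :=
    mul_nonneg (by linarith) hx0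
  have j2 : ((n:ℝ)^r - ((n-1).descFactorial r : ℝ)) * ((k:ℝ)/n)^r ≤
    ((n:ℝ)^r - ((n-1).descFactorial r : ℝ)) := mul_le_of_le_one_right (by linarith) hx1
  rw [sub_mul, hxe] at j1 j2
  rw [abs_le]
  constructor <;> linarith

/-- the drift -/
def D1 (n l : ℕ) (p : ℝ) (m : Fin l → ℕ) (α : Fin l → ℝ) (k : ℕ) : ℝ :=
  k * (1 - sg (h1 n l p m α (k-1))) - (n - k) * sg (h1 n l p m α k)

include hn hm in
lemma D1_diff (k : ℕ) (hk : k < n) :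
    |D1 n l p m α (k+1) - D1 n l p m α k| ≤ 2 * Calpha l p m α := by
  have hn' : (0:ℝ) < n := by exact_mod_cast hn
  have hC := Calpha_ge_two (l := l) (p := p) (m := m) (α := α)
  have s1 := (sg_lip _ _).trans (h1_diff hn hm (p := p) (α := α) k hk.le)
  have s2 : (k:ℝ) * |sg (h1 n l p m α k) - sg (h1 n l p m α (k-1))| ≤
      k * (Calpha l p m α * (1 / n)) := by
    rcases Nat.eq_zero_or_pos k with rfl | hp
    · simp
    · apply mul_le_mul_of_nonneg_left _ (by positivity)
      have := (sg_lip _ _).trans (h1_diff hn hm (p := p) (α := α) (k-1) (by omega))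
      rwa [Nat.sub_add_cancel hp] at this
  have e : D1 n l p m α (k+1) - D1 n l p m α k =
      1 - (k * (sg (h1 n l p m α k) - sg (h1 n l p m α (k-1))) +
        ((n:ℝ) - k - 1) * (sg (h1 n l p m α (k+1)) - sg (h1 n l p m α k))) := by
    unfold D1; rw [Nat.add_sub_cancel]; push_cast; ring
  have hk' : (k:ℝ) + 1 ≤ n := by exact_mod_cast hk
  have s3 := mul_le_mul_of_nonneg_left s1 (by linarith : (0:ℝ) ≤ (n:ℝ) - k - 1)
  rw [e]
  refine (abs_sub _ _).trans ?_
  have := abs_add_le (k * (sg (h1 n l p m α k) - sg (h1 n l p m α (k-1))))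
        (((n:ℝ) - k - 1) * (sg (h1 n l p m α (k+1)) - sg (h1 n l p m α k)))
  rw [abs_mul, abs_mul, abs_of_nonneg (by positivity : (0:ℝ) ≤ k),
    abs_of_nonneg (by linarith : (0:ℝ) ≤ (n:ℝ) - k - 1)] at this
  have e2 : (k:ℝ) * (Calpha l p m α * (1 / n)) + (n - k - 1) * (Calpha l p m α * (1 / n)) =
     Calpha l p m α * ((n-1)/n) := by ring
  have e3 : Calpha l p m α * (((n:ℝ)-1)/n) ≤ Calpha l p m α * 1 := by
    apply mul_le_mul_of_nonneg_left _ (by linarith)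
    rw [div_le_one hn']; linarith
  rw [abs_one]
  linarith

def w1 (n l : ℕ) (p : ℝ) (m : Fin l → ℕ) (α : Fin l → ℝ) (k : ℕ) : ℝ :=
  (n.choose k : ℝ) * exp (F1 n l p m α k)

include hn hm in
lemma second_moment :
    ∑ k ∈ Finset.range (n+1), w1 n l p m α k * (D1 n l p m α k)^2 ≤
      2 * n * Calpha l p m α * ∑ k ∈ Finset.range (n+1), w1 n l p m α k := by
  have hC := Calpha_ge_two (l := l) (p := p) (m := m) (α := α)
  have hw : ∀ k, 0 ≤ w1 n l p m α k := fun k => by unfold w1; positivity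
  set u : ℕ → ℝ := fun k => w1 n l p m α k * ((n - k) * sg (h1 n l p m α k)) with hu
  have bal : ∀ k < n, w1 n l p m α (k+1) * (((k+1:ℕ):ℝ) * (1 - sg (h1 n l p m α k))) = u k := by
    intro k hk
    have c := Nat.choose_succ_right_eq n k
    have c' : (n.choose (k+1) : ℝ) * ((k+1:ℕ):ℝ) = n.choose k * ((n:ℝ) - k) := by
      rw [← Nat.cast_sub hk.le]; exact_mod_cast c
    have b := sg_balance (h1 n l p m α k)
    have f : exp (F1 n l p m α (k+1)) = exp (F1 n l p m α k) * exp (2 * h1 n l p m α k) := by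
      rw [← exp_add, ← F1_diff hm]; ring_nf
    simp only [hu, w1]
    rw [f]
    calc _ = ((n.choose (k+1) : ℝ) * ((k+1:ℕ):ℝ)) * exp (F1 n l p m α k) *
          ((1 - sg (h1 n l p m α k)) * exp (2 * h1 n l p m α k)) := by ring
      _ = _ := by rw [c', b]; ring
  have e1 : ∑ k ∈ Finset.range (n+1), w1 n l p m α k * (D1 n l p m α k)^2 =
      ∑ k ∈ Finset.range (n+1), w1 n l p m α k * (k * (1 - sg (h1 n l p m α (k-1)))) * D1 n l p m α k
       - ∑ k ∈ Finset.range (n+1), u k * D1 n l p m α k := by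
    rw [← Finset.sum_sub_distrib]
    refine Finset.sum_congr rfl fun k _ => ?_
    have : (D1 n l p m α k)^2 = (k * (1 - sg (h1 n l p m α (k-1))) - (n - k) * sg (h1 n l p m α k)) *
      D1 n l p m α k := by rw [sq]; congr 1
    rw [this]; simp only [hu]; ring
  rw [e1, Finset.sum_range_succ', Finset.sum_range_succ (fun k => u k * D1 n l p m α k)]
  have un : u n = 0 := by simp [hu]
  rw [un]
  simp only [Nat.cast_zero, zero_mul, mul_zero, add_zero, Nat.add_sub_cancel]
  rw [← Finset.sum_sub_distrib]
  calc _ = ∑ k ∈ Finset.range n, u k * (D1 n l p m α (k+1) - D1 n l p m α k) := by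
        refine Finset.sum_congr rfl fun k hk => ?_
        rw [bal k (Finset.mem_range.1 hk)]; ring
    _ ≤ ∑ k ∈ Finset.range n, w1 n l p m α k * (2 * n * Calpha l p m α) := by
        refine Finset.sum_le_sum fun k hk => ?_
        have hk := Finset.mem_range.1 hk
        have hk' : (k:ℝ) ≤ n := by exact_mod_cast hk.le
        have := le_trans (le_abs_self _) (D1_diff hn hm (p := p) (α := α) k hk)
        have hsg := sg_nonneg (h1 n l p m α k)
        have hsg1 := sg_le_one (h1 n l p m α k)
        have hu1 : u k ≤ w1 n l p m α k * n := by
          apply mul_le_mul_of_nonneg_left _ (hw k)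
          have : (0:ℝ) ≤ k := by positivity
          calc _ ≤ ((n:ℝ) - k) * 1 := mul_le_mul_of_nonneg_left hsg1 (by linarith)
            _ ≤ n := by linarith
        have hu0 : 0 ≤ u k := mul_nonneg (hw k) (mul_nonneg (by linarith) hsg)
        calc _ ≤ u k * (2 * Calpha l p m α) := mul_le_mul_of_nonneg_left this hu0
          _ ≤ w1 n l p m α k * n * (2 * Calpha l p m α) :=
            mul_le_mul_of_nonneg_right hu1 (by linarith)
          _ = _ := by ring
    _ ≤ ∑ k ∈ Finset.range (n+1), w1 n l p m α k * (2 * n * Calpha l p m α) := by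
        rw [Finset.sum_range_succ]
        have := mul_nonneg (hw n) (by positivity : 0 ≤ 2 * (n:ℝ) * Calpha l p m α)
        linarith
    _ = _ := by rw [← Finset.sum_mul]; ring

include hn hm in
lemma D1_H1 (k : ℕ) (hk : k ≤ n) :
    (n:ℝ) * |(k:ℝ)/n - sg (H1 n l p m α ((k:ℝ)/n))| ≤
      |D1 n l p m α k| + Calpha l p m α * √n := by
  have hn' : (0:ℝ) < n := by exact_mod_cast hn
  have hk' : (k:ℝ) ≤ n := by exact_mod_cast hk
  have hC := Calpha_ge_two (l := l) (p := p) (m := m) (α := α)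
  set s := sg (H1 n l p m α ((k:ℝ)/n))
  have a1 := (sg_lip _ _).trans (h1_H1 hn hm (p := p) (α := α) k k hk le_rfl (by omega))
  have a2 := (sg_lip _ _).trans (h1_H1 hn hm (p := p) (α := α) k (k-1) hk (by omega) (by omega))
  rw [← abs_of_pos hn', ← abs_mul, abs_of_pos hn']
  have e : (n:ℝ) * ((k:ℝ)/n - s) = D1 n l p m α k + (k * (sg (h1 n l p m α (k-1)) - s) +
     (n-k) * (sg (h1 n l p m α k) - s)) := by
    unfold D1; field_simp; ring
  rw [e]
  refine (abs_add_le _ _).trans (add_le_add le_rfl ((abs_add_le _ _).trans ?_))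
  rw [abs_mul, abs_mul, abs_of_nonneg (by positivity : (0:ℝ) ≤ k),
    abs_of_nonneg (by linarith : (0:ℝ) ≤ (n:ℝ) - k)]
  have b1 := mul_le_mul_of_nonneg_left a2 (by positivity : (0:ℝ) ≤ k)
  have b2 := mul_le_mul_of_nonneg_left a1 (by linarith : (0:ℝ) ≤ (n:ℝ)-k)
  have e2 : Calpha l p m α * √n = k * (Calpha l p m α * (1 / √n)) +
      (n-k) * (Calpha l p m α * (1 / √n)) := by
    have : √(n:ℝ) ≠ 0 := by positivity
    have h := Real.sq_sqrt hn'.le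
    field_simp
    rw [h]; ring
  rw [e2]
  exact add_le_add b1 b2

end one

def cnt {n : ℕ} (X : Fin n → Bool) : ℕ := (Finset.univ.filter (fun i => X i = true)).card

lemma cnt_le {n : ℕ} (X : Fin n → Bool) : cnt X ≤ n := by
  unfold cnt
  simpa using Finset.card_le_univ (Finset.univ.filter (fun i => X i = true))

lemma emb_count {n r : ℕ} (P : Fin n → Prop) [DecidablePred P] :
    (Finset.univ.filter (fun g : Fin r ↪ Fin n => ∀ k, P (g k))).card =
      ((Finset.univ.filter P).card).descFactorial r := by
  have h1 : (Finset.univ.filter P).card = Fintype.card {i // P i} := by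
    rw [Fintype.card_subtype]
  rw [h1]
  conv_rhs => rw [← Fintype.card_fin r]
  rw [← Fintype.card_embedding_eq, ← Fintype.card_subtype]
  refine Fintype.card_congr ?_
  exact
    { toFun := fun g => ⟨fun k => ⟨g.1 k, g.2 k⟩, fun a b hab => by
        apply g.1.injective; simpa using hab⟩
      invFun := fun g => ⟨⟨fun k => (g k).1, fun a b hab => by
        apply g.injective; exact Subtype.ext hab⟩, fun k => (g k).2⟩
      left_inv := fun g => by ext; rfl
      right_inv := fun g => by ext; rfl }

lemma scf_bool (n l : ℕ) (p : ℝ) (m : Fin l → ℕ) (α : Fin l → ℝ) (X : Fin n → Bool) :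
    scf n l p m α (boolToR n X) = F1 n l p m α (cnt X) := by
  unfold scf F1
  congr 1
  · refine Finset.sum_congr rfl fun q _ => ?_
    congr 1
    have : ∀ g : Fin (m q) ↪ Fin n, ∏ k, boolToR n X (g k) =
        if (∀ k, X (g k) = true) then (1:ℝ) else 0 := by
      intro g
      unfold boolToR
      rw [Finset.prod_ite_zero]
      simp
    simp_rw [this]
    rw [Finset.sum_boole, emb_count (fun i => X i = true)]
    rfl
  · congr 1
    have : ∀ i, |boolToR n X i| = if X i = true then (1:ℝ) else 0 := by
      intro i; unfold boolToR; split_ifs <;> simp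
    simp_rw [this]
    rw [Finset.sum_boole]; rfl

lemma gradf_const (n l : ℕ) (p : ℝ) (m : Fin l → ℕ) (α : Fin l → ℝ) (x : ℝ) (j : Fin n) :
    gradf n l p m α (fun _ => x) j = H1 n l p m α x := by
  unfold gradf H1
  congr 1
  refine Finset.sum_congr rfl fun q _ => ?_
  congr 1
  unfold Cvec
  simp only [Finset.prod_const, Finset.sum_const, Finset.card_univ, Fintype.card_fin, nsmul_eq_mul]
  rw [emb_count (fun i => i ≠ j)]
  rw [Finset.filter_ne' Finset.univ j, Finset.card_erase_of_mem (Finset.mem_univ j)]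
  simp

lemma sum_cnt {n : ℕ} (g : ℕ → ℝ) :
    ∑ X : Fin n → Bool, g (cnt X) = ∑ k ∈ Finset.range (n+1), (n.choose k : ℝ) * g k := by
  have h := Finset.sum_powerset_apply_card g (x := (Finset.univ : Finset (Fin n)))
  simp only [Finset.card_univ, Fintype.card_fin, nsmul_eq_mul] at h
  rw [← h]
  refine Finset.sum_bij' (fun X _ => Finset.univ.filter (fun i => X i = true))
    (fun s _ => fun i => decide (i ∈ s)) ?_ ?_ ?_ ?_ ?_
  · intros; simp
  · intros; simp
  · intros; ext; simp
  · intros; ext; simp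
  · intros; rfl

lemma perm_of_cnt {n : ℕ} {X Y : Fin n → Bool} (h : cnt X = cnt Y) :
    ∃ τ : Equiv.Perm (Fin n), X ∘ τ = Y := by
  have hc : Fintype.card {i // Y i = true} = Fintype.card {i // X i = true} := by
    rw [Fintype.card_subtype, Fintype.card_subtype]; exact h.symm
  have e := Fintype.equivOfCardEq hc
  refine ⟨e.extendSubtype, ?_⟩
  funext i
  by_cases hi : Y i = true
  · have := e.extendSubtype_mem i hi
    simp [this, hi]
  · have := e.extendSubtype_not_mem i hi
    simp only [Bool.not_eq_true] at this hi
    simp [this, hi]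

def stdB (n k : ℕ) : Fin n → Bool := fun i => decide (i.val < k)

lemma cnt_std {n k : ℕ} (h : k ≤ n) : cnt (stdB n k) = k := by
  unfold cnt stdB
  simp [Fin.card_filter_val_lt, h]

lemma cnt_comp {n : ℕ} (X : Fin n → Bool) (τ : Equiv.Perm (Fin n)) : cnt (X ∘ τ) = cnt X := by
  unfold cnt
  refine Finset.card_bij (fun i _ => τ i) ?_ ?_ ?_
  · intro i; simp
  · intro a _ b _; simp
  · intro b hb; exact ⟨τ.symm b, by simpa using hb, by simp⟩

lemma sum_boolToR {n : ℕ} (X : Fin n → Bool) : ∑ i, boolToR n X i = cnt X := by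
  unfold boolToR cnt
  rw [Finset.sum_boole]

lemma norm1_std {n s k : ℕ} (hs : s ≤ n) (hk : k ≤ n) (τ : Equiv.Perm (Fin n)) :
    norm1 n (fun i => boolToR n (stdB n s ∘ τ) i - boolToR n (stdB n k ∘ τ) i) = |(s:ℝ) - k| := by
  have key : ∀ s k : ℕ, s ≤ n → k ≤ n → s ≤ k →
    ∑ i, |boolToR n (stdB n s) i - boolToR n (stdB n k) i| = |(s:ℝ) - k| := by
    intro s k hs hk hsk
    have : ∀ i, |boolToR n (stdB n s) i - boolToR n (stdB n k) i| =
        boolToR n (stdB n k) i - boolToR n (stdB n s) i := by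
      intro i
      unfold boolToR stdB
      by_cases h1 : i.val < s
      · have : i.val < k := by omega
        simp [h1, this]
      · by_cases h2 : i.val < k <;> simp [h1, h2]
    simp_rw [this]
    rw [Finset.sum_sub_distrib, sum_boolToR, sum_boolToR, cnt_std hs, cnt_std hk, abs_sub_comm,
      abs_of_nonneg]
    have : (s:ℝ) ≤ k := by exact_mod_cast hsk
    linarith
  unfold norm1
  have e := Equiv.sum_comp τ (fun i => |boolToR n (stdB n s) i - boolToR n (stdB n k) i|)
  have : ∑ i, |boolToR n (stdB n s ∘ τ) i - boolToR n (stdB n k ∘ τ) i| =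
     ∑ i, |boolToR n (stdB n s) i - boolToR n (stdB n k) i| := by
    rw [← e]; rfl
  rw [this]
  rcases le_total s k with h | h
  · exact key s k hs hk h
  · rw [abs_sub_comm (s:ℝ), ← key k s hk hs h]
    exact Finset.sum_congr rfl fun i _ => abs_sub_comm _ _

open scoped ENNReal in
lemma avg_perm {n : ℕ} (c : ℕ → ℝ≥0∞) (φ : (Fin n → Bool) → ℝ≥0∞) :
    ∑ τ : Equiv.Perm (Fin n), ∑ X : Fin n → Bool, c (cnt X) * φ (stdB n (cnt X) ∘ τ) =
      (n.factorial : ℝ≥0∞) * ∑ X : Fin n → Bool, c (cnt X) * φ X := by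
  rw [Finset.sum_comm]
  have h1 : ∀ X : Fin n → Bool, ∑ τ : Equiv.Perm (Fin n), c (cnt X) * φ (stdB n (cnt X) ∘ τ) =
      ∑ τ : Equiv.Perm (Fin n), c (cnt X) * φ (X ∘ τ) := by
    intro X
    obtain ⟨σ, hσ⟩ := perm_of_cnt (X := X) (Y := stdB n (cnt X)) (cnt_std (cnt_le X)).symm
    rw [← Equiv.sum_comp (Equiv.mulLeft σ) (fun τ : Equiv.Perm (Fin n) => c (cnt X) * φ (X ∘ τ))]
    refine Finset.sum_congr rfl fun τ _ => ?_
    rw [← hσ]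
    rfl
  simp_rw [h1]
  rw [Finset.sum_comm]
  have h2 : ∀ τ : Equiv.Perm (Fin n), ∑ X : Fin n → Bool, c (cnt X) * φ (X ∘ τ) =
      ∑ X : Fin n → Bool, c (cnt X) * φ X := by
    intro τ
    rw [← Equiv.sum_comp (Equiv.arrowCongr τ.symm (Equiv.refl Bool)) (fun X => c (cnt X) * φ X)]
    refine Finset.sum_congr rfl fun X _ => ?_
    have : (Equiv.arrowCongr τ.symm (Equiv.refl Bool)) X = X ∘ τ := by
      funext i; simp [Equiv.arrowCongr]
    rw [this, cnt_comp]
  simp_rw [h2]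
  rw [Finset.sum_const, Finset.card_univ, Fintype.card_perm, Fintype.card_fin, nsmul_eq_mul]

section meas
open scoped ENNReal

def dm {ι E : Type*} [Fintype ι] [MeasurableSpace E] (w : ι → ℝ≥0∞) (pt : ι → E) : Measure E :=
  ∑ i, w i • Measure.dirac (pt i)

variable {ι E : Type*} [Fintype ι] [MeasurableSpace E]

lemma dm_apply [MeasurableSingletonClass E] (w : ι → ℝ≥0∞) (pt : ι → E) (s : Set E) :
    dm w pt s = ∑ i, w i * s.indicator 1 (pt i) := by
  unfold dm
  simp [Measure.finsetSum_apply]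

lemma dm_lintegral [MeasurableSingletonClass E] (w : ι → ℝ≥0∞) (pt : ι → E) (f : E → ℝ≥0∞) :
    ∫⁻ x, f x ∂(dm w pt) = ∑ i, w i * f (pt i) := by
  unfold dm
  rw [lintegral_finsetSum_measure]
  refine Finset.sum_congr rfl fun i _ => ?_
  rw [lintegral_smul_measure, lintegral_dirac, smul_eq_mul]

lemma dm_ae [MeasurableSingletonClass E] {F : Type*} [MeasurableSpace F] [Nonempty F]
    (w : ι → ℝ≥0∞) (pt : ι → E) (f : E → F) : AEMeasurable f (dm w pt) := by
  classical
  let S : Finset E := Finset.univ.image pt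
  have hS : (S : Set E).Finite := S.finite_toSet
  have c : F := Classical.arbitrary F
  refine ⟨(S : Set E).piecewise f (fun _ => c), ?_, ?_⟩
  · intro t ht
    rw [Set.piecewise_preimage]
    unfold Set.ite
    refine MeasurableSet.union ?_ ?_
    · exact (hS.subset Set.inter_subset_right).measurableSet
    · exact (measurable_const ht).diff hS.measurableSet
  · rw [Filter.EventuallyEq, ae_iff, dm_apply]
    refine Finset.sum_eq_zero fun i _ => ?_
    have : pt i ∈ (S : Set E) := by simp [S]
    rw [Set.indicator_of_notMem, mul_zero]
    simp only [Set.mem_ofPred_eq, not_not]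
    rw [Set.piecewise_eq_of_mem _ _ _ this]

lemma dm_bind [MeasurableSingletonClass E] {F : Type*} [MeasurableSpace F]
    (w : ι → ℝ≥0∞) (pt : ι → E) (f : E → Measure F) {s : Set F} (hs : MeasurableSet s) :
    (dm w pt).bind f s = ∑ i, w i * f (pt i) s := by
  rw [Measure.bind_apply hs (dm_ae w pt f), dm_lintegral]

lemma dm_integral [MeasurableSingletonClass E] (w : ι → ℝ) (hw : ∀ i, 0 ≤ w i)
    (pt : ι → E) (f : E → ℝ) :
    ∫ x, f x ∂(dm (fun i => ENNReal.ofReal (w i)) pt) = ∑ i, w i * f (pt i) := by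
  unfold dm
  rw [integral_finsetSum_measure]
  · refine Finset.sum_congr rfl fun i _ => ?_
    rw [integral_smul_measure, integral_dirac, ENNReal.toReal_ofReal (hw i), smul_eq_mul]
  · intro i _
    refine Integrable.smul_measure ?_ ENNReal.ofReal_ne_top
    exact integrable_dirac (by simp)

lemma dm_prob (w : ι → ℝ≥0∞) (pt : ι → E) (hw : ∑ i, w i = 1) : IsProbabilityMeasure (dm w pt) := by
  constructor
  unfold dm
  simp [Measure.finsetSum_apply, hw]

/-- product weights -/
def B1 (n : ℕ) (x : ℝ) (s : ℕ) : ℝ := x ^ s * (1 - x) ^ (n - s)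

lemma prod_B1 {n : ℕ} (x : ℝ) (Y : Fin n → Bool) :
    ∏ i, (if Y i = true then x else 1 - x) = B1 n x (cnt Y) := by
  rw [Finset.prod_ite, Finset.prod_const, Finset.prod_const]
  unfold B1 cnt
  congr 2
  have := Finset.card_filter_add_card_filter_not (s := (Finset.univ : Finset (Fin n))) (fun i => Y i = true)
  rw [Finset.card_univ, Fintype.card_fin] at this
  omega

lemma pi_bern {n : ℕ} {x : ℝ} (hx0 : 0 ≤ x) (hx1 : x ≤ 1) :
    (Measure.pi fun _ : Fin n => bern x) =
      dm (fun Y : Fin n → Bool => ENNReal.ofReal (B1 n x (cnt Y))) (boolToR n) := by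
  have : SigmaFinite (bern x) := by
    unfold bern; infer_instance
  refine Measure.pi_eq ?_
  intro s hs
  rw [dm_apply]
  have hb : ∀ i, bern x (s i) = ∑ b : Bool, ENNReal.ofReal (if b = true then x else 1 - x) *
      (s i).indicator 1 (if b = true then (1:ℝ) else 0) := by
    intro i
    unfold bern
    simp [ENNReal.ofReal]
    rfl
  simp_rw [hb]
  rw [Fintype.prod_sum]
  refine Finset.sum_congr rfl fun Y _ => ?_
  rw [Finset.prod_mul_distrib]
  congr 1
  · rw [← ENNReal.ofReal_prod_of_nonneg, prod_B1]
    intro i _; split_ifs <;> linarith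
  · classical
    simp only [Set.indicator_apply, Pi.one_apply]
    rw [Finset.prod_ite_zero]
    simp [Set.mem_pi, boolToR]

lemma sum_B1 {n : ℕ} (x : ℝ) : ∑ Y : Fin n → Bool, B1 n x (cnt Y) = 1 := by
  simp_rw [← prod_B1]
  rw [← Fintype.prod_sum (fun (_ : Fin n) (b : Bool) => if b = true then x else 1 - x)]
  simp

lemma var_B1 {n : ℕ} (x : ℝ) :
    ∑ Y : Fin n → Bool, B1 n x (cnt Y) * ((cnt Y : ℝ) - n * x)^2 = n * x * (1 - x) := by
  rw [sum_cnt (fun s => B1 n x s * ((s:ℝ) - n * x)^2)]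
  have h := congrArg (Polynomial.eval x) (bernsteinPolynomial.variance ℝ n)
  rw [Polynomial.eval_finsetSum] at h
  simp [bernsteinPolynomial] at h
  rw [← h]
  refine Finset.sum_congr rfl fun k _ => ?_
  unfold B1; ring

lemma abs_B1 {n : ℕ} (hn : 0 < n) {x : ℝ} (hx0 : 0 ≤ x) (hx1 : x ≤ 1) :
    ∑ Y : Fin n → Bool, B1 n x (cnt Y) * |(cnt Y : ℝ) - n * x| ≤ √n := by
  have hn' : (0:ℝ) < n := by exact_mod_cast hn
  have hs : 0 < √(n:ℝ) := by positivity
  have hsq := Real.sq_sqrt hn'.le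
  have hB : ∀ s, 0 ≤ B1 n x s := fun s => by
    unfold B1; have : 0 ≤ 1 - x := by linarith
    positivity
  have : ∑ Y : Fin n → Bool, B1 n x (cnt Y) * |(cnt Y : ℝ) - n * x| ≤
     ∑ Y : Fin n → Bool, (B1 n x (cnt Y) * ((cnt Y : ℝ) - n * x)^2 * (1 / (2 * √n)) +
       B1 n x (cnt Y) * (√n/2)) := by
    refine Finset.sum_le_sum fun Y _ => ?_
    rw [mul_assoc, ← mul_add]
    refine mul_le_mul_of_nonneg_left ?_ (hB _)
    rw [← sq_abs]
    set d := |(cnt Y : ℝ) - n * x|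
    have e : d ^ 2 * (1 / (2 * √n)) + √n/2 = (d^2 + √n^2) / (2*√n) := by field_simp
    rw [e, le_div_iff₀ (by positivity)]
    nlinarith [sq_nonneg (d - √n)]
  refine this.trans ?_
  rw [Finset.sum_add_distrib, ← Finset.sum_mul, ← Finset.sum_mul, var_B1, sum_B1]
  have i : (n:ℝ) * x * (1-x) * (1 / (2*√n)) ≤ √n / 2 := by
    have : (n:ℝ) * x * (1-x) ≤ n := by
      rw [mul_assoc]; apply mul_le_of_le_one_right hn'.le; nlinarith
    rw [mul_one_div, div_le_iff₀ (by positivity)]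
    nlinarith
  linarith

end meas

section final
open scoped ENNReal

def Zp (n l : ℕ) (p : ℝ) (m : Fin l → ℕ) (α : Fin l → ℝ) : ℝ :=
  ∑ X : Fin n → Bool, exp (F1 n l p m α (cnt X))

def A1 (n l : ℕ) (p : ℝ) (m : Fin l → ℕ) (α : Fin l → ℝ) (k : ℕ) : ℝ :=
  exp (F1 n l p m α k) / Zp n l p m α

variable {n l : ℕ} {p : ℝ} {m : Fin l → ℕ} {α : Fin l → ℝ}

lemma Zp_pos : 0 < Zp n l p m α := by
  unfold Zp
  exact Finset.sum_pos (fun X _ => exp_pos _) Finset.univ_nonempty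

lemma A1_nonneg (k : ℕ) : 0 ≤ A1 n l p m α k := by
  have := Zp_pos (n := n) (p := p) (m := m) (α := α)
  unfold A1; positivity

lemma sum_A1 : ∑ X : Fin n → Bool, A1 n l p m α (cnt X) = 1 := by
  unfold A1
  rw [← Finset.sum_div]
  exact div_self (Zp_pos (n := n) (p := p) (m := m) (α := α)).ne'

lemma gibbs_eq : gibbs n (scf n l p m α) =
    dm (fun X : Fin n → Bool => ENNReal.ofReal (A1 n l p m α (cnt X))) (boolToR n) := by
  unfold gibbs dm
  simp_rw [scf_bool]
  rw [Finset.smul_sum]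
  refine Finset.sum_congr rfl fun X _ => ?_
  rw [smul_smul]
  congr 1
  unfold A1
  rw [ENNReal.ofReal_div_of_pos Zp_pos, mul_comm, div_eq_mul_inv]
  congr 2
  unfold Zp
  rw [ENNReal.ofReal_sum_of_nonneg]
  intro i _; positivity

lemma moment_A1 (hn : 0 < n) (hm : ∀ q, 2 ≤ m q) :
    ∑ X : Fin n → Bool, A1 n l p m α (cnt X) * (D1 n l p m α (cnt X))^2 ≤
      2 * n * Calpha l p m α := by
  have h := second_moment hn hm (p := p) (α := α)
  have e1 := sum_cnt (n := n) (fun k => exp (F1 n l p m α k) * (D1 n l p m α k)^2)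
  have e2 := sum_cnt (n := n) (fun k => exp (F1 n l p m α k))
  simp only [w1, mul_assoc] at h
  rw [← e1, ← e2] at h
  have hZ := Zp_pos (n := n) (p := p) (m := m) (α := α)
  have : ∑ X : Fin n → Bool, A1 n l p m α (cnt X) * (D1 n l p m α (cnt X))^2 =
    (∑ X : Fin n → Bool, exp (F1 n l p m α (cnt X)) * (D1 n l p m α (cnt X))^2) / Zp n l p m α := by
    rw [Finset.sum_div]
    refine Finset.sum_congr rfl fun X _ => ?_
    unfold A1; ring
  rw [this, div_le_iff₀ hZ]
  unfold Zp
  linarith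

def ptc (n : ℕ) (X : Fin n → Bool) : Fin n → ℝ := fun _ => (cnt X : ℝ) / n

lemma x_mem (hn : 0 < n) (X : Fin n → Bool) : 0 ≤ (cnt X : ℝ) / n ∧ (cnt X : ℝ) / n ≤ 1 := by
  have hn' : (0:ℝ) < n := by exact_mod_cast hn
  refine ⟨by positivity, ?_⟩
  rw [div_le_one hn']; exact_mod_cast cnt_le X

lemma norm_pt (hn : 0 < n) (hm : ∀ q, 2 ≤ m q) (X : Fin n → Bool) :
    norm1 n (fun j => ptc n X j - Phi n l p m α (ptc n X) j) ≤
      |D1 n l p m α (cnt X)| + Calpha l p m α * √n := by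
  refine le_trans (le_of_eq ?_) (D1_H1 hn hm (cnt X) (cnt_le X))
  unfold norm1 Phi ptc
  simp only [gradf_const]
  simp [sg]

lemma bad_pt (hn : 0 < n) (hm : ∀ q, 2 ≤ m q) (X : Fin n → Bool)
    (hX : ptc n X ∉ Xf n l p m α) :
    (Calpha l p m α * (n:ℝ)^((7:ℝ)/8))^2 ≤ (D1 n l p m α (cnt X))^2 := by
  have hC := Calpha_ge_two (l := l) (p := p) (m := m) (α := α)
  have hn1 : (1:ℝ) ≤ n := by exact_mod_cast hn
  have hN : √(n:ℝ) ≤ (n:ℝ)^((7:ℝ)/8) := by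
    rw [Real.sqrt_eq_rpow]
    exact Real.rpow_le_rpow_of_exponent_le hn1 (by norm_num)
  have h0 : 0 ≤ √(n:ℝ) := Real.sqrt_nonneg _
  have hX' : 5000 * (Calpha l p m α) ^ 2 * (n : ℝ) ^ ((7:ℝ)/8) <
      norm1 n (fun j => ptc n X j - Phi n l p m α (ptc n X) j) := by
    by_contra hc
    push Not at hc
    exact hX ⟨fun i => ⟨(x_mem hn X).1, (x_mem hn X).2⟩, hc⟩
  have := norm_pt hn hm X (p := p) (α := α)
  rw [← sq_abs (D1 n l p m α (cnt X))]
  set N := (n:ℝ)^((7:ℝ)/8)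
  set C := Calpha l p m α
  have hN0 : 0 ≤ N := h0.trans hN
  have a1 : C * √n ≤ C * N := by gcongr
  have a2 : C * N ≤ C^2 * N := by
    apply mul_le_mul_of_nonneg_right _ hN0; nlinarith
  have a3 : 0 ≤ C * N := by positivity
  apply pow_le_pow_left₀ a3
  linarith

lemma good_prob (hn : 0 < n) (hm : ∀ q, 2 ≤ m q) :
    dm (fun X : Fin n → Bool => ENNReal.ofReal (A1 n l p m α (cnt X))) (ptc n) (Xf n l p m α) ≥
      ENNReal.ofReal (1 - 80 * (Calpha l p m α) ^ ((1:ℝ)/4) * (n : ℝ) ^ (-(1:ℝ)/8)) := by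
  classical
  have hC := Calpha_ge_two (l := l) (p := p) (m := m) (α := α)
  have hn1 : (1:ℝ) ≤ n := by exact_mod_cast hn
  have hn0 : (0:ℝ) < n := by linarith
  rw [dm_apply]
  have e : ∀ X : Fin n → Bool, ENNReal.ofReal (A1 n l p m α (cnt X)) *
      (Xf n l p m α).indicator 1 (ptc n X) =
      ENNReal.ofReal (A1 n l p m α (cnt X) * if ptc n X ∈ Xf n l p m α then 1 else 0) := by
    intro X
    by_cases h : ptc n X ∈ Xf n l p m α <;> simp [h]
  simp_rw [e]
  rw [← ENNReal.ofReal_sum_of_nonneg (fun X _ => by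
    have := A1_nonneg (n := n) (p := p) (m := m) (α := α) (cnt X)
    split_ifs <;> simp [this])]
  apply ENNReal.ofReal_le_ofReal
  set C := Calpha l p m α with hCdef
  set N := (n:ℝ)^((7:ℝ)/8) with hNdef
  set ε := (n:ℝ)^(-(1:ℝ)/8) with hεdef
  have hN0 : 0 < N := by positivity
  have hε0 : 0 < ε := by positivity
  have hNε : (n:ℝ) ≤ N^2 * ε := by
    have : N^2 * ε = (n:ℝ)^((13:ℝ)/8) := by
      rw [hNdef, hεdef, ← Real.rpow_natCast, ← Real.rpow_mul hn0.le, ← Real.rpow_add hn0]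
      norm_num
    rw [this]
    calc (n:ℝ) = (n:ℝ)^(1:ℝ) := (Real.rpow_one _).symm
      _ ≤ _ := Real.rpow_le_rpow_of_exponent_le hn1 (by norm_num)
  have hT : 0 < (C * N)^2 := by positivity
  have key : ∑ X : Fin n → Bool, A1 n l p m α (cnt X) * (1 - (D1 n l p m α (cnt X))^2 / (C*N)^2) ≤
     ∑ X : Fin n → Bool, A1 n l p m α (cnt X) * if ptc n X ∈ Xf n l p m α then 1 else 0 := by
    refine Finset.sum_le_sum fun X _ => ?_
    refine mul_le_mul_of_nonneg_left ?_ (A1_nonneg _)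
    split_ifs with h
    · have : 0 ≤ (D1 n l p m α (cnt X))^2 / (C*N)^2 := by positivity
      linarith
    · have := bad_pt hn hm X h
      rw [← one_le_div hT] at this
      linarith
  refine le_trans ?_ key
  have e2 : ∑ X : Fin n → Bool, A1 n l p m α (cnt X) * (1 - (D1 n l p m α (cnt X))^2 / (C*N)^2) =
      1 - (∑ X : Fin n → Bool, A1 n l p m α (cnt X) * (D1 n l p m α (cnt X))^2) / (C*N)^2 := by
    rw [Finset.sum_div]
    conv_rhs => rw [← sum_A1 (n := n) (p := p) (m := m) (α := α)]
    rw [← Finset.sum_sub_distrib]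
    refine Finset.sum_congr rfl fun X _ => ?_
    ring
  rw [e2]
  have hmom := moment_A1 hn hm (p := p) (α := α)
  have b1 : (∑ X : Fin n → Bool, A1 n l p m α (cnt X) * (D1 n l p m α (cnt X))^2) / (C*N)^2 ≤ ε := by
    rw [div_le_iff₀ hT]
    refine hmom.trans ?_
    have : 2 * (n:ℝ) * C ≤ 2 * (N^2*ε) * C := by gcongr
    refine this.trans ?_
    have h3 : 0 ≤ N^2 * ε * C := by positivity
    calc 2 * (N^2*ε) * C = (N^2*ε*C) * 2 := by ring
      _ ≤ (N^2*ε*C) * C := by gcongr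
      _ = _ := by ring
  have b2 : 1 ≤ C^((1:ℝ)/4) := Real.one_le_rpow (by linarith) (by norm_num)
  have b3 : ε ≤ 80 * C^((1:ℝ)/4) * ε := by
    apply le_mul_of_one_le_left hε0.le; linarith
  linarith

def cplW (n l : ℕ) (p : ℝ) (m : Fin l → ℕ) (α : Fin l → ℝ)
    (t : Equiv.Perm (Fin n) × (Fin n → Bool) × (Fin n → Bool)) : ℝ :=
  ((n.factorial : ℝ))⁻¹ * (A1 n l p m α (cnt t.2.1) * B1 n ((cnt t.2.1 : ℝ)/n) (cnt t.2.2))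

def cplP (n : ℕ) (t : Equiv.Perm (Fin n) × (Fin n → Bool) × (Fin n → Bool)) :
    (Fin n → ℝ) × (Fin n → ℝ) :=
  (boolToR n (stdB n (cnt t.2.2) ∘ t.1), boolToR n (stdB n (cnt t.2.1) ∘ t.1))

lemma B1_nonneg' (hn : 0 < n) (X : Fin n → Bool) (s : ℕ) : 0 ≤ B1 n ((cnt X : ℝ)/n) s := by
  have := x_mem hn X
  unfold B1
  have h : 0 ≤ 1 - (cnt X : ℝ)/n := by linarith [this.2]
  positivity

lemma cplW_nonneg (hn : 0 < n) (t) : 0 ≤ cplW n l p m α t := by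
  unfold cplW
  have := A1_nonneg (n := n) (p := p) (m := m) (α := α) (cnt t.2.1)
  have := B1_nonneg' hn t.2.1 (cnt t.2.2)
  positivity

lemma cplW_ofReal (hn : 0 < n) (τ : Equiv.Perm (Fin n)) (X Y : Fin n → Bool) :
    ENNReal.ofReal (cplW n l p m α (τ, X, Y)) = ((n.factorial : ℝ≥0∞))⁻¹ *
      (ENNReal.ofReal (A1 n l p m α (cnt X)) * ENNReal.ofReal (B1 n ((cnt X : ℝ)/n) (cnt Y))) := by
  unfold cplW
  rw [ENNReal.ofReal_mul (by positivity), ENNReal.ofReal_mul (A1_nonneg _),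
    ENNReal.ofReal_inv_of_pos (by positivity), ENNReal.ofReal_natCast]

lemma sum_B1_enn (hn : 0 < n) (X : Fin n → Bool) :
    ∑ Y : Fin n → Bool, ENNReal.ofReal (B1 n ((cnt X : ℝ)/n) (cnt Y)) = 1 := by
  rw [← ENNReal.ofReal_sum_of_nonneg (fun Y _ => B1_nonneg' hn X _), sum_B1, ENNReal.ofReal_one]

lemma sum_A1_enn : ∑ X : Fin n → Bool, ENNReal.ofReal (A1 n l p m α (cnt X)) = 1 := by
  rw [← ENNReal.ofReal_sum_of_nonneg (fun Y _ => A1_nonneg _), sum_A1, ENNReal.ofReal_one]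

lemma fact_cancel (y : ℝ≥0∞) : ((n.factorial : ℝ≥0∞))⁻¹ * ((n.factorial : ℝ≥0∞) * y) = y := by
  rw [← mul_assoc, ENNReal.inv_mul_cancel, one_mul]
  · exact_mod_cast n.factorial_ne_zero
  · exact ENNReal.natCast_ne_top _

lemma cpl_fst_sum (hn : 0 < n) (φ : (Fin n → Bool) → ℝ≥0∞) :
    ∑ t, ENNReal.ofReal (cplW n l p m α t) * φ (stdB n (cnt t.2.2) ∘ t.1) =
    ∑ X : Fin n → Bool, ENNReal.ofReal (A1 n l p m α (cnt X)) *
      ∑ Y : Fin n → Bool, ENNReal.ofReal (B1 n ((cnt X : ℝ)/n) (cnt Y)) * φ Y := by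
  rw [Fintype.sum_prod_type]
  simp_rw [Fintype.sum_prod_type]
  rw [Finset.sum_comm]
  refine Finset.sum_congr rfl fun X _ => ?_
  simp_rw [cplW_ofReal hn, mul_assoc, ← Finset.mul_sum]
  rw [avg_perm (fun s => ENNReal.ofReal (B1 n ((cnt X : ℝ)/n) s)) φ]
  rw [mul_left_comm, fact_cancel]

lemma cpl_snd_sum (hn : 0 < n) (φ : (Fin n → Bool) → ℝ≥0∞) :
    ∑ t, ENNReal.ofReal (cplW n l p m α t) * φ (stdB n (cnt t.2.1) ∘ t.1) =
    ∑ X : Fin n → Bool, ENNReal.ofReal (A1 n l p m α (cnt X)) * φ X := by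
  rw [Fintype.sum_prod_type]
  simp_rw [Fintype.sum_prod_type]
  have : ∀ (τ : Equiv.Perm (Fin n)) (X : Fin n → Bool),
      ∑ Y : Fin n → Bool, ENNReal.ofReal (cplW n l p m α (τ, X, Y)) * φ (stdB n (cnt X) ∘ τ) =
      ((n.factorial : ℝ≥0∞))⁻¹ * (ENNReal.ofReal (A1 n l p m α (cnt X)) * φ (stdB n (cnt X) ∘ τ)) := by
    intro τ X
    rw [← Finset.sum_mul]
    simp_rw [cplW_ofReal hn, ← Finset.mul_sum]
    rw [sum_B1_enn hn, mul_one, mul_assoc]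
  simp_rw [this, ← Finset.mul_sum]
  rw [avg_perm (fun s => ENNReal.ofReal (A1 n l p m α s)) φ, fact_cancel]

lemma cpl_cost (hn : 0 < n) :
    ∫ z, norm1 n (fun i => z.1 i - z.2 i)
      ∂(dm (fun t => ENNReal.ofReal (cplW n l p m α t)) (cplP n)) ≤ √n := by
  have hn0 : (n:ℝ) ≠ 0 := by positivity
  rw [dm_integral _ (cplW_nonneg hn)]
  have e : ∀ t, norm1 n (fun i => (cplP n t).1 i - (cplP n t).2 i) =
      |(cnt t.2.2 : ℝ) - cnt t.2.1| := fun t => norm1_std (cnt_le _) (cnt_le _) _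
  simp_rw [e]
  rw [Fintype.sum_prod_type]
  simp only [cplW]
  rw [Finset.sum_const, Finset.card_univ, Fintype.card_perm, Fintype.card_fin, nsmul_eq_mul]
  simp_rw [mul_assoc]
  rw [← Finset.mul_sum, ← mul_assoc, mul_inv_cancel₀ (by positivity), one_mul, Fintype.sum_prod_type]
  calc _ ≤ ∑ X : Fin n → Bool, A1 n l p m α (cnt X) * √n := by
        refine Finset.sum_le_sum fun X _ => ?_
        simp only
        rw [← Finset.mul_sum]
        refine mul_le_mul_of_nonneg_left ?_ (A1_nonneg _)
        have := abs_B1 hn (x_mem hn X).1 (x_mem hn X).2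
        rwa [mul_div_cancel₀ _ hn0] at this
    _ = _ := by rw [← Finset.sum_mul, sum_A1, one_mul]

end final

/-- there is a probability measure `ρ` on `[0,1]ⁿ` with
`ρ(X_f) ≥ 1 - 80 C_α^{1/4} n^{-1/8}` and a coupling `π` of `G(n,ρ)` and the Gibbs
measure `μ_f` with `∫ ‖x - y‖₁ dπ ≤ 80 C_α^{1/4} n^{7/8}`. -/
theorem stmt5 (n l : ℕ) (hn : 0 < n) (p : ℝ) (hp : p ∈ Set.Ioo (0:ℝ) 1)
    (m : Fin l → ℕ) (hm : ∀ q, 2 ≤ m q) (hminj : Function.Injective m)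
    (α : Fin l → ℝ) :
    ∃ ρ : Measure (Fin n → ℝ), IsProbabilityMeasure ρ ∧
      ρ {x | ∀ i, x i ∈ Set.Icc (0:ℝ) 1} = 1 ∧
      ρ (Xf n l p m α) ≥
        ENNReal.ofReal (1 - 80 * (Calpha l p m α) ^ ((1:ℝ)/4) * (n : ℝ) ^ (-(1:ℝ)/8)) ∧
      ∃ cpl : Measure ((Fin n → ℝ) × (Fin n → ℝ)), IsProbabilityMeasure cpl ∧
        cpl.map Prod.fst = Gmix n ρ ∧
        cpl.map Prod.snd = gibbs n (scf n l p m α) ∧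
        ∫ z, norm1 n (fun i => z.1 i - z.2 i) ∂cpl ≤
          80 * (Calpha l p m α) ^ ((1:ℝ)/4) * (n : ℝ) ^ ((7:ℝ)/8) := by
  classical
  refine ⟨dm (fun X : Fin n → Bool => ENNReal.ofReal (A1 n l p m α (cnt X))) (ptc n),
    dm_prob _ _ sum_A1_enn, ?_, good_prob hn hm,
    dm (fun t => ENNReal.ofReal (cplW n l p m α t)) (cplP n), ?_, ?_, ?_, ?_⟩
  · rw [dm_apply, ← sum_A1_enn (n := n) (p := p) (m := m) (α := α)]
    refine Finset.sum_congr rfl fun X _ => ?_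
    rw [Set.indicator_of_mem, Pi.one_apply, mul_one]
    exact fun i => ⟨(x_mem hn X).1, (x_mem hn X).2⟩
  · apply dm_prob
    have := cpl_snd_sum hn (l := l) (p := p) (m := m) (α := α) (fun _ => 1)
    simp only [mul_one] at this
    rw [this, sum_A1_enn]
  · ext s hs
    rw [Measure.map_apply measurable_fst hs, dm_apply, Gmix, dm_bind _ _ _ hs]
    have h := cpl_fst_sum hn (l := l) (p := p) (m := m) (α := α)
      (fun Y => s.indicator 1 (boolToR n Y))
    refine Eq.trans ?_ (h.trans ?_)
    · rfl
    · refine Finset.sum_congr rfl fun X _ => ?_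
      have hb := pi_bern (n := n) (x_mem hn X).1 (x_mem hn X).2
      simp only [ptc]
      rw [hb, dm_apply]
  · rw [gibbs_eq]
    ext s hs
    rw [Measure.map_apply measurable_snd hs, dm_apply, dm_apply]
    have h := cpl_snd_sum hn (l := l) (p := p) (m := m) (α := α)
      (fun Y => s.indicator 1 (boolToR n Y))
    refine Eq.trans ?_ h
    rfl
  · refine (cpl_cost hn).trans ?_
    have hC := Calpha_ge_two (l := l) (p := p) (m := m) (α := α)
    have hn1 : (1:ℝ) ≤ n := by exact_mod_cast hn
    have hN : √(n:ℝ) ≤ (n:ℝ)^((7:ℝ)/8) := by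
      rw [Real.sqrt_eq_rpow]
      exact Real.rpow_le_rpow_of_exponent_le hn1 (by norm_num)
    have b2 : 1 ≤ (Calpha l p m α)^((1:ℝ)/4) := Real.one_le_rpow (by linarith) (by norm_num)
    refine hN.trans (le_mul_of_one_le_left (by positivity) (by linarith))

end
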